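/- If f and g are log-concave probability densities on ℝ^d, then their convolution f ∗ g, given by (f ∗ g)(x) = ∫_{ℝ^d} f(x − y) g(y) dy, is a log-concave probability density on ℝ^d. -/

import Mathlib

open MeasureTheory Filter Set
open scoped ENNReal Topology

noncomputable section

/-- `ℝ^d` with its Euclidean norm and Lebesgue measure. -/
abbrev Rd (d : ℕ) : Type := EuclideanSpace ℝ (Fin d)

/-- A nonnegative function is log-concave (`log f` is concave, with `log 0 := -∞`),
expressed multiplicatively via `f x ^ (1-t) * f y ^ t ≤ f ((1-t) • x + t • y)`. -/
def IsLogConcaveFn {E : Type*} [AddCommGroup E] [Module ℝ E] (f : E → ℝ) : Prop :=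
  (∀ x, 0 ≤ f x) ∧
  ∀ x y : E, ∀ t : ℝ, t ∈ Set.Icc (0:ℝ) 1 →
    f x ^ (1 - t) * f y ^ t ≤ f ((1 - t) • x + t • y)

/-- A probability density with respect to the (Lebesgue) measure of a `MeasureSpace`. -/
def IsDensity {E : Type*} [MeasureSpace E] (f : E → ℝ) : Prop :=
  (∀ x, 0 ≤ f x) ∧ Measurable f ∧ ∫⁻ x, ENNReal.ofReal (f x) = 1

/-- Membership in the class `F_d`: an upper semi-continuous log-concave probability
density. -/
def IsLCDensity {E : Type*} [MeasureSpace E] [TopologicalSpace E] [AddCommGroup E]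
    [Module ℝ E] (f : E → ℝ) : Prop :=
  IsDensity f ∧ UpperSemicontinuous f ∧ IsLogConcaveFn f

/-- Membership in the class `P_d`: probability measures with finite first moment that are
not concentrated on any affine hyperplane `{x | l x = c}` (`l` a nonzero linear
functional). -/
def MemP {E : Type*} [NormedAddCommGroup E] [NormedSpace ℝ E] [MeasureSpace E]
    (P : Measure E) : Prop :=
  IsProbabilityMeasure P ∧ Integrable (fun x => ‖x‖) P ∧
  ∀ (l : E →ₗ[ℝ] ℝ) (c : ℝ), l ≠ 0 → P {x | l x = c} < 1

/-- The log-concave projection predicate: `fs ∈ F_d` maximises `∫ log f dP` over `F_d`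
(candidates whose objective is `-∞`, i.e. that vanish on a set of positive `P`-measure or
have non-integrable logarithm, are trivially dominated). -/
def IsLCProj {E : Type*} [NormedAddCommGroup E] [NormedSpace ℝ E] [MeasureSpace E]
    (P : Measure E) (fs : E → ℝ) : Prop :=
  IsLCDensity fs ∧ (∀ᵐ x ∂P, 0 < fs x) ∧ Integrable (fun x => Real.log (fs x)) P ∧
  ∀ g : E → ℝ, IsLCDensity g → (∀ᵐ x ∂P, 0 < g x) →
    Integrable (fun x => Real.log (g x)) P →
    ∫ x, Real.log (g x) ∂P ≤ ∫ x, Real.log (fs x) ∂P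

/-- `log y` with values in `[-∞, ∞)`, with the convention `log 0 := -∞`. -/
def elog (y : ℝ) : EReal := if y ≤ 0 then ⊥ else ((Real.log y : ℝ) : EReal)

/-- Positive part of an extended real number, as an `ℝ≥0∞`. -/
def epos (a : EReal) : ℝ≥0∞ := if a = ⊤ then ⊤ else ENNReal.ofReal a.toReal

/-- `e^a` for an extended real `a`, valued in `[0,∞]`. -/
def expE (a : EReal) : ℝ≥0∞ :=
  if a = ⊥ then 0 else if a = ⊤ then ⊤ else ENNReal.ofReal (Real.exp a.toReal)

/-- Integral of an `EReal`-valued function: positive part minus negative part. -/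
def erealIntegral {α : Type*} [MeasurableSpace α] (P : Measure α) (φ : α → EReal) : EReal :=
  ((∫⁻ x, epos (φ x) ∂P : ℝ≥0∞) : EReal) - ((∫⁻ x, epos (-(φ x)) ∂P : ℝ≥0∞) : EReal)

/-- The class `Φ`: upper semi-continuous, concave functions `φ : E → [-∞, ∞)` with
`φ(x) → -∞` as `‖x‖ → ∞`. -/
def MemPhi {E : Type*} [NormedAddCommGroup E] [NormedSpace ℝ E] (φ : E → EReal) : Prop :=
  (∀ x, φ x ≠ ⊤) ∧ UpperSemicontinuous φ ∧
  (∀ x y : E, ∀ t : ℝ, t ∈ Set.Icc (0:ℝ) 1 →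
    (((1 - t : ℝ)) : EReal) * φ x + ((t : ℝ) : EReal) * φ y ≤ φ ((1 - t) • x + t • y)) ∧
  Tendsto φ (Filter.comap (fun x => ‖x‖) Filter.atTop) (nhds ⊥)

/-- The functional `L(φ, P) = ∫ φ dP - ∫ e^φ dx`. -/
def Lfun {E : Type*} [NormedAddCommGroup E] [NormedSpace ℝ E] [MeasureSpace E]
    (φ : E → EReal) (P : Measure E) : EReal :=
  erealIntegral P φ - ((∫⁻ x, expE (φ x) : ℝ≥0∞) : EReal)

/-- `L*(P) = sup_{φ ∈ Φ} L(φ, P)`. -/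
def Lstar {E : Type*} [NormedAddCommGroup E] [NormedSpace ℝ E] [MeasureSpace E]
    (P : Measure E) : EReal :=
  ⨆ (φ : E → EReal) (_ : MemPhi φ), Lfun φ P

/-- Action of a matrix on a Euclidean vector. -/
def mulVE {m d : ℕ} (A : Matrix (Fin m) (Fin d) ℝ) (x : Rd d) : Rd m :=
  (WithLp.equiv 2 (Fin m → ℝ)).symm (A.mulVec ((WithLp.equiv 2 (Fin d → ℝ)) x))

open scoped NNReal Pointwise

/-- The one-dimensional Brunn-Minkowski inequality for compact sets. -/
lemma volume_add_volume_le_of_isCompact {K L : Set ℝ} (hK : IsCompact K) (hL : IsCompact L)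
    (hK0 : K.Nonempty) (hL0 : L.Nonempty) : volume K + volume L ≤ volume (K + L) := by
  have ha := hK.sSup_mem hK0
  have hb := hL.sInf_mem hL0
  set a := sSup K
  set b := sInf L
  have hmeas : NullMeasurableSet (a +ᵥ L) :=
    (hL.vadd a).measurableSet.nullMeasurableSet
  have hinter : (b +ᵥ K) ∩ (a +ᵥ L) ⊆ {a + b} := by
    rintro _ ⟨⟨x, hx, rfl⟩, ⟨y, hy, hxy⟩⟩
    have h1 : x ≤ a := le_csSup hK.bddAbove hx
    have h2 : b ≤ y := csInf_le hL.bddBelow hy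
    simp only [vadd_eq_add, mem_singleton_iff] at hxy ⊢
    linarith
  have hdisj : AEDisjoint volume (b +ᵥ K) (a +ᵥ L) :=
    measure_mono_null hinter (measure_singleton _)
  calc volume K + volume L = volume (b +ᵥ K) + volume (a +ᵥ L) := by
        rw [measure_vadd, measure_vadd]
    _ = volume ((b +ᵥ K) ∪ (a +ᵥ L)) := (measure_union₀ hmeas hdisj).symm
    _ ≤ volume (K + L) := by
        refine measure_mono (union_subset ?_ ?_)
        · rintro _ ⟨x, hx, rfl⟩
          exact ⟨x, hx, b, hb, add_comm _ _⟩
        · rintro _ ⟨y, hy, rfl⟩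
          exact ⟨a, ha, y, hy, rfl⟩

/-- The one-dimensional Brunn-Minkowski inequality for measurable sets. -/
lemma volume_add_volume_le {A B : Set ℝ} (hA : MeasurableSet A) (hB : MeasurableSet B)
    (hA0 : A.Nonempty) (hB0 : B.Nonempty) : volume A + volume B ≤ volume (A + B) := by
  rcases eq_or_ne (volume A) 0 with h | hA'
  · obtain ⟨a, ha⟩ := hA0
    rw [h, zero_add, ← measure_vadd volume a B]
    exact measure_mono (image_subset_iff.2 fun b hb => ⟨a, ha, b, hb, rfl⟩)
  rcases eq_or_ne (volume B) 0 with h | hB'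
  · obtain ⟨b, hb⟩ := hB0
    rw [h, add_zero, ← measure_vadd volume b A]
    exact measure_mono (image_subset_iff.2 fun a ha => ⟨a, ha, b, hb, add_comm a b⟩)
  by_contra! hlt
  obtain ⟨r, hr, s, hs, hrs⟩ := ENNReal.exists_lt_add_of_lt_add hlt hA' hB'
  refine hrs.not_ge ?_
  obtain ⟨K, hKA, hK, hrK⟩ := hA.exists_lt_isCompact hr
  obtain ⟨L, hLB, hL, hsL⟩ := hB.exists_lt_isCompact hs
  calc r + s ≤ volume K + volume L := add_le_add hrK.le hsL.le
    _ ≤ volume (K + L) := volume_add_volume_le_of_isCompact hK hL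
        (nonempty_of_measure_ne_zero (ne_bot_of_gt hrK))
        (nonempty_of_measure_ne_zero (ne_bot_of_gt hsL))
    _ ≤ volume (A + B) := measure_mono (add_subset_add hKA hLB)

/-- Layer cake formula for functions bounded by one. -/
lemma lintegral_eq_lintegral_Ioo_of_le_one {α : Type*} [MeasurableSpace α] (μ : Measure α)
    {F : α → ℝ≥0∞} (hF : Measurable F) (hF1 : ∀ x, F x ≤ 1) :
    ∫⁻ x, F x ∂μ = ∫⁻ s in Ioo (0 : ℝ) 1, μ {x | ENNReal.ofReal s < F x} := by
  have hne : ∀ x, F x ≠ ∞ := fun x => ((hF1 x).trans_lt ENNReal.one_lt_top).ne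
  have h := lintegral_eq_lintegral_meas_lt μ (f := fun x => (F x).toReal)
    (ae_of_all _ fun x => ENNReal.toReal_nonneg) hF.ennreal_toReal.aemeasurable
  simp only [ENNReal.ofReal_toReal (hne _)] at h
  rw [h, ← Ioo_union_Ici_eq_Ioi (zero_lt_one' ℝ),
    lintegral_union measurableSet_Ici (by
      rw [Set.disjoint_left]; intro x hx hx'; exact absurd hx.2 (not_lt.2 hx'))]
  have h0 : ∫⁻ s in Ici (1 : ℝ), μ {x | s < (F x).toReal} = 0 := by
    rw [setLIntegral_congr_fun (g := fun _ => 0) measurableSet_Ici, lintegral_zero]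
    intro s hs
    have : {x | s < (F x).toReal} = ∅ := by
      ext x
      have : (F x).toReal ≤ 1 := ENNReal.toReal_le_of_le_ofReal zero_le_one (by simpa using hF1 x)
      simpa using this.trans hs
    simp [this]
  rw [h0, add_zero]
  refine setLIntegral_congr_fun measurableSet_Ioo fun s hs => ?_
  congr 1
  ext x
  simp [ENNReal.ofReal_lt_iff_lt_toReal hs.1.le (hne x)]

/-- Weighted AM-GM inequality for extended nonnegative reals. -/
lemma rpow_mul_rpow_le_add {t : ℝ} (ht : t ∈ Ioo (0 : ℝ) 1) (a b : ℝ≥0∞) :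
    a ^ (1 - t) * b ^ t ≤ ENNReal.ofReal (1 - t) * a + ENNReal.ofReal t * b := by
  have h1 : 0 < 1 - t := by linarith [ht.2]
  rcases eq_or_ne a ∞ with rfl | ha
  · rw [ENNReal.mul_top (by simpa using ht.2), top_add]
    exact le_top
  rcases eq_or_ne b ∞ with rfl | hb
  · rw [ENNReal.mul_top (by simpa using ht.1), add_top]
    exact le_top
  lift a to ℝ≥0 using ha
  lift b to ℝ≥0 using hb
  have := Real.geom_mean_le_arith_mean2_weighted h1.le ht.1.le a.coe_nonneg b.coe_nonneg (by ring)
  have h := ENNReal.ofReal_le_ofReal this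
  have ha : (0 : ℝ) ≤ a := a.2
  have hb : (0 : ℝ) ≤ b := b.2
  rwa [ENNReal.ofReal_add (mul_nonneg h1.le ha) (mul_nonneg ht.1.le hb), ENNReal.ofReal_mul h1.le,
    ENNReal.ofReal_mul ht.1.le, ENNReal.ofReal_mul (Real.rpow_nonneg ha _),
    ← ENNReal.ofReal_rpow_of_nonneg ha h1.le, ← ENNReal.ofReal_rpow_of_nonneg hb ht.1.le,
    ENNReal.ofReal_coe_nnreal, ENNReal.ofReal_coe_nnreal] at h

/-- The Prékopa-Leindler inequality on the line for functions with supremum one. -/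
lemma lintegral_add_le_of_iSup_eq_one {t : ℝ} (ht : t ∈ Ioo (0 : ℝ) 1) {F G H : ℝ → ℝ≥0∞}
    (hF : Measurable F) (hG : Measurable G) (hH : Measurable H) (hF1 : ⨆ x, F x = 1)
    (hG1 : ⨆ x, G x = 1) (hH1 : ∀ x, H x ≤ 1)
    (h : ∀ x y, F x ^ (1 - t) * G y ^ t ≤ H ((1 - t) • x + t • y)) :
    ENNReal.ofReal (1 - t) * (∫⁻ x, F x) + ENNReal.ofReal t * (∫⁻ x, G x) ≤ ∫⁻ x, H x := by
  have h1 : 0 < 1 - t := by linarith [ht.2]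
  have hmeas : ∀ F : ℝ → ℝ≥0∞, Measurable fun s : ℝ => volume {x | ENNReal.ofReal s < F x} := by
    intro F
    refine Antitone.measurable fun r s hrs => measure_mono fun x hx => ?_
    exact (ENNReal.ofReal_le_ofReal hrs).trans_lt hx
  rw [lintegral_eq_lintegral_Ioo_of_le_one volume hF (fun x => hF1 ▸ le_iSup F x),
    lintegral_eq_lintegral_Ioo_of_le_one volume hG (fun x => hG1 ▸ le_iSup G x),
    lintegral_eq_lintegral_Ioo_of_le_one volume hH hH1,
    ← lintegral_const_mul _ (hmeas F), ← lintegral_const_mul _ (hmeas G),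
    ← lintegral_add_left ((hmeas F).const_mul _)]
  refine setLIntegral_mono (hmeas H) fun s hs => ?_
  have hs1 : ENNReal.ofReal s < 1 := by simpa using hs.2
  have hA0 : {x | ENNReal.ofReal s < F x}.Nonempty := lt_iSup_iff.1 (hs1.trans_eq hF1.symm)
  have hB0 : {x | ENNReal.ofReal s < G x}.Nonempty := lt_iSup_iff.1 (hs1.trans_eq hG1.symm)
  have hA : MeasurableSet {x | ENNReal.ofReal s < F x} := measurableSet_lt measurable_const hF
  have hB : MeasurableSet {x | ENNReal.ofReal s < G x} := measurableSet_lt measurable_const hG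
  have hsub : (1 - t) • {x | ENNReal.ofReal s < F x} + t • {x | ENNReal.ofReal s < G x} ⊆
      {x | ENNReal.ofReal s < H x} := by
    rintro _ ⟨_, ⟨x, hx, rfl⟩, _, ⟨y, hy, rfl⟩, rfl⟩
    refine lt_of_lt_of_le ?_ (h x y)
    calc ENNReal.ofReal s = ENNReal.ofReal s ^ (1 - t) * ENNReal.ofReal s ^ t := by
          rw [← ENNReal.rpow_add _ _ (by simpa using hs.1) ENNReal.ofReal_ne_top]
          simp
      _ < F x ^ (1 - t) * G y ^ t :=
          ENNReal.mul_lt_mul (ENNReal.rpow_lt_rpow hx h1) (ENNReal.rpow_lt_rpow hy ht.1)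
  calc _ = volume ((1 - t) • {x | ENNReal.ofReal s < F x}) +
        volume (t • {x | ENNReal.ofReal s < G x}) := by
        rw [Measure.addHaar_smul, Measure.addHaar_smul]
        simp [abs_of_pos h1, abs_of_pos ht.1]
    _ ≤ _ := volume_add_volume_le (hA.const_smul₀ _) (hB.const_smul₀ _) hA0.smul_set hB0.smul_set
    _ ≤ _ := measure_mono hsub

/-- The Prékopa-Leindler inequality holds on `E`. -/
def PrekopaLeindler (E : Type*) [AddCommGroup E] [Module ℝ E] [MeasureSpace E] : Prop :=
  ∀ (t : ℝ) (F G H : E → ℝ≥0∞), t ∈ Ioo (0 : ℝ) 1 → Measurable F → Measurable G → Measurable H →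
    (∀ x y, F x ^ (1 - t) * G y ^ t ≤ H ((1 - t) • x + t • y)) →
    (∫⁻ x, F x) ^ (1 - t) * (∫⁻ x, G x) ^ t ≤ ∫⁻ x, H x

/-- The Prékopa-Leindler inequality on the line for bounded functions. -/
lemma lintegral_rpow_mul_le_of_bounded {t : ℝ} (ht : t ∈ Ioo (0 : ℝ) 1) {F G H : ℝ → ℝ≥0∞}
    (hF : Measurable F) (hG : Measurable G) (hH : Measurable H) (hF1 : ⨆ x, F x ≠ ∞)
    (hG1 : ⨆ x, G x ≠ ∞)
    (h : ∀ x y, F x ^ (1 - t) * G y ^ t ≤ H ((1 - t) • x + t • y)) :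
    (∫⁻ x, F x) ^ (1 - t) * (∫⁻ x, G x) ^ t ≤ ∫⁻ x, H x := by
  have h1 : 0 < 1 - t := by linarith [ht.2]
  rcases eq_or_ne (⨆ x, F x) 0 with ha0 | ha0
  · rw [ENNReal.iSup_eq_zero] at ha0
    simp [ha0, h1]
  rcases eq_or_ne (⨆ x, G x) 0 with hb0 | hb0
  · rw [ENNReal.iSup_eq_zero] at hb0
    simp [hb0, ht.1]
  set a := ⨆ x, F x
  set b := ⨆ x, G x
  set c := a ^ (1 - t) * b ^ t with hc
  have hc0 : c ≠ 0 := by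
    simp [hc, ha0, hb0, hF1, hG1]
  have hct : c ≠ ∞ := ENNReal.mul_ne_top (ENNReal.rpow_ne_top_of_nonneg h1.le hF1)
    (ENNReal.rpow_ne_top_of_nonneg ht.1.le hG1)
  have hcinv : c⁻¹ = a⁻¹ ^ (1 - t) * b⁻¹ ^ t := by
    rw [hc, ENNReal.mul_inv, ENNReal.inv_rpow, ENNReal.inv_rpow]
    · right; exact ENNReal.rpow_ne_top_of_nonneg ht.1.le hG1
    · left; exact ENNReal.rpow_ne_top_of_nonneg h1.le hF1
  have hmul : ∀ p q : ℝ≥0∞, (a⁻¹ * p) ^ (1 - t) * (b⁻¹ * q) ^ t =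
      c⁻¹ * (p ^ (1 - t) * q ^ t) := by
    intro p q
    rw [ENNReal.mul_rpow_of_nonneg _ _ h1.le, ENNReal.mul_rpow_of_nonneg _ _ ht.1.le, hcinv]
    ring
  have hFs : ⨆ x, a⁻¹ * F x = 1 := by
    rw [← ENNReal.mul_iSup, ENNReal.inv_mul_cancel ha0 hF1]
  have hGs : ⨆ x, b⁻¹ * G x = 1 := by
    rw [← ENNReal.mul_iSup, ENNReal.inv_mul_cancel hb0 hG1]
  have key := lintegral_add_le_of_iSup_eq_one ht (hF.const_mul a⁻¹) (hG.const_mul b⁻¹)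
    ((hH.const_mul c⁻¹).min measurable_const) hFs hGs (fun x => min_le_right _ 1) (by
      intro x y
      refine le_min ?_ ?_
      · rw [hmul]
        gcongr
        exact h x y
      · exact mul_le_one' (ENNReal.rpow_le_one (hFs ▸ le_iSup (fun x => a⁻¹ * F x) x) h1.le)
          (ENNReal.rpow_le_one (hGs ▸ le_iSup (fun x => b⁻¹ * G x) y) ht.1.le))
  have key2 := (rpow_mul_rpow_le_add ht _ _).trans
    (key.trans (lintegral_mono fun x => min_le_left _ _))
  rw [lintegral_const_mul _ hF, lintegral_const_mul _ hG, lintegral_const_mul _ hH, hmul] at key2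
  exact (ENNReal.mul_le_mul_iff_right (ENNReal.inv_ne_zero.2 hct) (ENNReal.inv_ne_top.2 hc0)).1 key2

/-- Truncations of a function have integrals converging to that of the function. -/
lemma tendsto_lintegral_min_natCast {α : Type*} [MeasurableSpace α] (μ : Measure α)
    {F : α → ℝ≥0∞} (hF : Measurable F) :
    Tendsto (fun n : ℕ => ∫⁻ x, min (F x) n ∂μ) atTop (𝓝 (∫⁻ x, F x ∂μ)) := by
  refine lintegral_tendsto_of_tendsto_of_monotone
    (fun n => (hF.min measurable_const).aemeasurable) (ae_of_all _ fun x m n hmn => ?_)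
    (ae_of_all _ fun x => ?_)
  · exact min_le_min_left _ (by exact_mod_cast hmn)
  · simpa using (tendsto_const_nhds (x := F x)).min ENNReal.tendsto_nat_nhds_top

lemma prekopaLeindler_real : PrekopaLeindler ℝ := by
  intro t F G H ht hF hG hH h
  have h1 : 0 < 1 - t := by linarith [ht.2]
  rcases eq_or_ne (∫⁻ x, F x) 0 with ha0 | ha0
  · simp [ha0, h1]
  rcases eq_or_ne (∫⁻ x, G x) 0 with hb0 | hb0
  · simp [hb0, ht.1]
  have hlim := ENNReal.Tendsto.mul
    ((tendsto_lintegral_min_natCast volume hF).ennrpow_const (1 - t))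
    (Or.inl (by simp [ha0, h1, ht.2.le]))
    ((tendsto_lintegral_min_natCast volume hG).ennrpow_const t)
    (Or.inl (by simp [hb0, ht.1, ht.1.le]))
  have hbdd : ∀ (F : ℝ → ℝ≥0∞) (n : ℕ), ⨆ x, min (F x) (n : ℝ≥0∞) ≠ ∞ := fun F n =>
    ((iSup_le fun x => min_le_right _ _).trans_lt (ENNReal.natCast_lt_top n)).ne
  refine le_of_tendsto' hlim fun n => lintegral_rpow_mul_le_of_bounded ht
    (hF.min measurable_const) (hG.min measurable_const) hH (hbdd F n) (hbdd G n) fun x y => ?_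
  refine le_trans ?_ (h x y)
  gcongr
  · exact min_le_left _ _
  · exact ht.1.le
  · exact min_le_left _ _

lemma PrekopaLeindler.prod {E E' : Type*} [AddCommGroup E] [Module ℝ E] [MeasureSpace E]
    [AddCommGroup E'] [Module ℝ E'] [MeasureSpace E'] [SFinite (volume : Measure E')]
    (hE : PrekopaLeindler E) (hE' : PrekopaLeindler E') : PrekopaLeindler (E × E') := by
  intro t F G H ht hF hG hH h
  rw [Measure.volume_eq_prod, lintegral_prod _ hF.aemeasurable, lintegral_prod _ hG.aemeasurable,
    lintegral_prod _ hH.aemeasurable]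
  refine hE t _ _ _ ht hF.lintegral_prod_right' hG.lintegral_prod_right' hH.lintegral_prod_right'
    fun x y => ?_
  exact hE' t _ _ _ ht (hF.comp measurable_prodMk_left) (hG.comp measurable_prodMk_left)
    (hH.comp measurable_prodMk_left) fun u v => h (x, u) (y, v)

lemma PrekopaLeindler.of_measurableEquiv {E E' : Type*} [AddCommGroup E] [Module ℝ E]
    [MeasureSpace E] [AddCommGroup E'] [Module ℝ E'] [MeasureSpace E'] (e : E ≃ᵐ E')
    (he : MeasurePreserving e) (hlin : IsLinearMap ℝ e) (hE : PrekopaLeindler E) :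
    PrekopaLeindler E' := by
  intro t F G H ht hF hG hH h
  rw [← he.lintegral_comp hF, ← he.lintegral_comp hG, ← he.lintegral_comp hH]
  refine hE t _ _ _ ht (hF.comp e.measurable) (hG.comp e.measurable) (hH.comp e.measurable)
    fun x y => ?_
  rw [hlin.map_add, hlin.map_smul, hlin.map_smul]
  exact h _ _

lemma prekopaLeindler_pi : ∀ d : ℕ, PrekopaLeindler (Fin d → ℝ)
  | 0 => by
    intro t F G H ht hF hG hH h
    rw [Measure.volume_pi_eq_dirac, lintegral_dirac, lintegral_dirac, lintegral_dirac]
    exact (h _ _).trans_eq (congrArg H (Subsingleton.elim _ _))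
  | d + 1 => by
    refine (prekopaLeindler_real.prod (prekopaLeindler_pi d)).of_measurableEquiv
      (MeasurableEquiv.piFinSuccAbove (fun _ : Fin (d + 1) => ℝ) 0).symm
      (volume_preserving_piFinSuccAbove (fun _ : Fin (d + 1) => ℝ) 0).symm ⟨?_, ?_⟩
    · intro x y
      ext i
      refine Fin.cases ?_ (fun j => ?_) i <;> simp [MeasurableEquiv.piFinSuccAbove]
    · intro c x
      ext i
      refine Fin.cases ?_ (fun j => ?_) i <;> simp [MeasurableEquiv.piFinSuccAbove]

lemma prekopaLeindler_euclideanSpace (d : ℕ) : PrekopaLeindler (EuclideanSpace ℝ (Fin d)) :=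
  (prekopaLeindler_pi d).of_measurableEquiv (MeasurableEquiv.toLp 2 (Fin d → ℝ))
    (PiLp.volume_preserving_toLp (Fin d)) ⟨fun _ _ => rfl, fun _ _ => rfl⟩

/-- A log-concave probability density is bounded. -/
lemma IsDensity.exists_forall_le {d : ℕ} {f : Rd d → ℝ} (hf : IsDensity f)
    (hflc : IsLogConcaveFn f) : ∃ C, ∀ x, f x ≤ C := by
  obtain ⟨hf0, hfm, hf1⟩ := hf
  obtain ⟨n, hn⟩ : ∃ n : ℕ, 0 < volume {x | 1 / ((n : ℝ) + 1) < f x} := by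
    refine exists_measure_pos_of_not_measure_iUnion_null fun hnull => ?_
    have hae : (fun x => ENNReal.ofReal (f x)) =ᵐ[volume] 0 := by
      refine measure_mono_null (fun x hx => ?_) hnull
      have hx0 : 0 < f x := by simpa using hx
      exact mem_iUnion.2 (exists_nat_one_div_lt hx0)
    rw [lintegral_congr_ae hae] at hf1
    simp at hf1
  set ε : ℝ := 1 / ((n : ℝ) + 1)
  have hε : 0 < ε := by positivity
  set A := {x | ε < f x}
  set c := volume ((2⁻¹ : ℝ) • A)
  have hc : c ≠ 0 := by
    simp only [c, Measure.addHaar_smul]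
    exact mul_ne_zero (by simp) hn.ne'
  refine ⟨((c⁻¹).toReal / ε ^ (2⁻¹ : ℝ)) ^ 2, fun x => ?_⟩
  have hsub : ((2⁻¹ : ℝ) • x) +ᵥ ((2⁻¹ : ℝ) • A) ⊆
      {z | ENNReal.ofReal (f x ^ (2⁻¹ : ℝ) * ε ^ (2⁻¹ : ℝ)) ≤ ENNReal.ofReal (f z)} := by
    rintro _ ⟨_, ⟨y, hy, rfl⟩, rfl⟩
    refine ENNReal.ofReal_le_ofReal ?_
    have h := hflc.2 x y 2⁻¹ ⟨by norm_num, by norm_num⟩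
    rw [show (1 : ℝ) - 2⁻¹ = 2⁻¹ by norm_num] at h
    refine le_trans ?_ h
    have hy' : ε ≤ f y := le_of_lt hy
    have := hf0 x
    gcongr
  have hle : ENNReal.ofReal (f x ^ (2⁻¹ : ℝ) * ε ^ (2⁻¹ : ℝ)) * c ≤ 1 := by
    rw [← hf1]
    refine le_trans ?_ (mul_meas_ge_le_lintegral hfm.ennreal_ofReal
      (ENNReal.ofReal (f x ^ (2⁻¹ : ℝ) * ε ^ (2⁻¹ : ℝ))))
    gcongr
    exact (measure_vadd volume ((2⁻¹ : ℝ) • x) _).symm.trans_le (measure_mono hsub)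
  have hle' := ENNReal.le_inv_iff_mul_le.2 hle
  have h2 := (ENNReal.ofReal_le_iff_le_toReal (ENNReal.inv_ne_top.2 hc)).1 hle'
  have h3 : f x ^ (2⁻¹ : ℝ) ≤ (c⁻¹).toReal / ε ^ (2⁻¹ : ℝ) := by
    rwa [le_div_iff₀ (by positivity)]
  calc f x = (f x ^ (2⁻¹ : ℝ)) ^ 2 := by
        rw [← Real.rpow_natCast, ← Real.rpow_mul (hf0 x)]
        norm_num
    _ ≤ _ := pow_le_pow_left₀ (Real.rpow_nonneg (hf0 x) _) h3 2

/-- The convolution of two log-concave probability densities on `ℝ^d` is a log-concave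
probability density. -/
theorem statement3 (d : ℕ) (f g : Rd d → ℝ)
    (hf : IsDensity f) (hg : IsDensity g)
    (hflc : IsLogConcaveFn f) (hglc : IsLogConcaveFn g) :
    IsDensity (fun x : Rd d => ∫ y, f (x - y) * g y) ∧
    IsLogConcaveFn (fun x : Rd d => ∫ y, f (x - y) * g y) := by
  obtain ⟨hf0, hfm, hf1⟩ := id hf
  obtain ⟨hg0, hgm, hg1⟩ := hg
  obtain ⟨C, hC⟩ := hf.exists_forall_le hflc
  have hm2 : Measurable fun p : Rd d × Rd d => ENNReal.ofReal (f (p.1 - p.2) * g p.2) :=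
    ((hfm.comp (measurable_fst.sub measurable_snd)).mul (hgm.comp measurable_snd)).ennreal_ofReal
  have hm : ∀ x, Measurable fun y => ENNReal.ofReal (f (x - y) * g y) := fun x =>
    hm2.comp measurable_prodMk_left
  set c : Rd d → ℝ≥0∞ := fun x => ∫⁻ y, ENNReal.ofReal (f (x - y) * g y)
  have hcm : Measurable c := hm2.lintegral_prod_right'
  have hct : ∀ x, c x ≠ ∞ := by
    intro x
    refine ne_top_of_le_ne_top (b := ENNReal.ofReal C) ENNReal.ofReal_ne_top ?_
    calc c x ≤ ∫⁻ y, ENNReal.ofReal C * ENNReal.ofReal (g y) := by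
          refine lintegral_mono fun y => ?_
          rw [← ENNReal.ofReal_mul ((hf0 x).trans (hC x))]
          exact ENNReal.ofReal_le_ofReal (mul_le_mul_of_nonneg_right (hC _) (hg0 y))
      _ = ENNReal.ofReal C := by
          rw [lintegral_const_mul _ hgm.ennreal_ofReal, hg1, mul_one]
  have hconv : (fun x => ∫ y, f (x - y) * g y) = fun x => (c x).toReal := by
    ext x
    refine integral_eq_lintegral_of_nonneg_ae
      (ae_of_all _ fun y => mul_nonneg (hf0 _) (hg0 _)) ?_
    exact ((hfm.comp (measurable_const.sub measurable_id)).mul hgm).aestronglyMeasurable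
  rw [hconv]
  refine ⟨⟨fun x => ENNReal.toReal_nonneg, hcm.ennreal_toReal, ?_⟩,
    fun x => ENNReal.toReal_nonneg, fun x y t ht => ?_⟩
  · simp only [ENNReal.ofReal_toReal (hct _)]
    rw [lintegral_lintegral_swap hm2.aemeasurable, ← hg1]
    refine lintegral_congr fun y => ?_
    simp only [ENNReal.ofReal_mul (hf0 _)]
    have hfy : Measurable fun x => f (x - y) := hfm.comp (measurable_sub_const y)
    rw [lintegral_mul_const _ hfy.ennreal_ofReal,
      lintegral_sub_right_eq_self (fun x => ENNReal.ofReal (f x)) y, hf1, one_mul]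
  · rcases eq_or_lt_of_le ht.1 with rfl | ht0
    · simp
    rcases eq_or_lt_of_le ht.2 with rfl | ht1
    · simp
    have h1 : 0 < 1 - t := sub_pos.2 ht1
    have key := prekopaLeindler_euclideanSpace d t _ _ _ ⟨ht0, ht1⟩ (hm x) (hm y)
      (hm ((1 - t) • x + t • y)) fun u v => by
        rw [ENNReal.ofReal_rpow_of_nonneg (mul_nonneg (hf0 _) (hg0 _)) h1.le,
          ENNReal.ofReal_rpow_of_nonneg (mul_nonneg (hf0 _) (hg0 _)) ht0.le,
          ← ENNReal.ofReal_mul (Real.rpow_nonneg (mul_nonneg (hf0 _) (hg0 _)) _),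
          Real.mul_rpow (hf0 _) (hg0 _), Real.mul_rpow (hf0 _) (hg0 _), mul_mul_mul_comm]
        refine ENNReal.ofReal_le_ofReal (mul_le_mul ?_ (hglc.2 u v t ht)
          (mul_nonneg (Real.rpow_nonneg (hg0 _) _) (Real.rpow_nonneg (hg0 _) _)) (hf0 _))
        rw [show (1 - t) • x + t • y - ((1 - t) • u + t • v) =
          (1 - t) • (x - u) + t • (y - v) by module]
        exact hflc.2 (x - u) (y - v) t ht
    rw [ENNReal.toReal_rpow, ENNReal.toReal_rpow, ← ENNReal.toReal_mul]
    exact ENNReal.toReal_mono (hct _) key
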